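/- Let n ≥ 2 and let F : F_2^n → F_2^n be an APN permutation. Then there is no (n-1)-dimensional affine subspace A_1 of F_2^n and affine subspace A_2 with F(A_1) = A_2. More generally, if F(A_1) = A_2 for affine subspaces A_1, A_2, then dim A_1 ∉ {2, 4, n-1}. -/

import Mathlib

/-- The four-point form, in characteristic two, of almost perfect nonlinearity. -/
def IsAPN {V W : Type*} [AddCommGroup V] [AddCommGroup W] (F : V → W) : Prop :=
  ∀ x y z, F x + F y + F z + F (x + y + z) = 0 → x = y ∨ x = z ∨ y = z

/-- The nontrivial additive character of `ZMod 2`, with integer values. -/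
def signChar (a : ZMod 2) : ℤ := if a = 0 then 1 else -1

lemma signChar_add (a b : ZMod 2) : signChar (a + b) = signChar a * signChar b := by
  revert a b; decide

lemma signChar_zero : signChar 0 = 1 := rfl

lemma four_dvd_one_sub_signChar_mul (a b : ZMod 2) :
    (4 : ℤ) ∣ (1 - signChar a) * (1 - signChar b) := by
  revert a b; decide

lemma eight_dvd_one_sub_signChar_mul (a b c : ZMod 2) :
    (8 : ℤ) ∣ (1 - signChar a) * (1 - signChar b) * (1 - signChar c) := by
  revert a b c; decide

lemma sum_signChar_dotProduct {n : ℕ} (v : Fin n → ZMod 2) :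
    ∑ u : Fin n → ZMod 2, signChar (u ⬝ᵥ v) = if v = 0 then 2 ^ n else 0 := by
  split_ifs with hv
  · simp [hv, signChar_zero, ZMod.card]
  · obtain ⟨i, hi⟩ := Function.ne_iff.mp hv
    have hi1 : v i = 1 := by
      revert hi; simp only [Pi.zero_apply]; generalize v i = a; revert a; decide
    have h := Equiv.sum_comp (Equiv.addRight (Pi.single i (1 : ZMod 2)))
      (fun u : Fin n → ZMod 2 => signChar (u ⬝ᵥ v))
    have h1 : signChar (1 : ZMod 2) = -1 := rfl
    simp only [Equiv.coe_addRight, add_dotProduct, single_dotProduct, hi1,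
      signChar_add, h1, mul_neg, mul_one, Finset.sum_neg_distrib] at h
    linarith

/-- The Walsh transform of a Boolean function. -/
def walsh {n : ℕ} (f : (Fin n → ZMod 2) → ZMod 2) (u : Fin n → ZMod 2) : ℤ :=
  ∑ x, signChar (f x + u ⬝ᵥ x)

lemma add_eq_zero_iff_eq_of_zmod_two {V : Type*} [AddCommGroup V] [Module (ZMod 2) V]
    (x y : V) : x + y = 0 ↔ x = y := by
  rw [add_eq_zero_iff_eq_neg, ZModModule.neg_eq_self]

lemma sum_walsh_sq {n : ℕ} (f : (Fin n → ZMod 2) → ZMod 2) :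
    ∑ u, walsh f u ^ 2 = 2 ^ n * 2 ^ n := by
  have h (u : Fin n → ZMod 2) : walsh f u ^ 2 =
      ∑ x, ∑ y, signChar (f x + f y) * signChar (u ⬝ᵥ (x + y)) := by
    rw [walsh, sq, Finset.sum_mul_sum]
    simp only [signChar_add, dotProduct_add]
    exact Finset.sum_congr rfl fun x _ => Finset.sum_congr rfl fun y _ => by ring
  simp only [h]
  rw [Finset.sum_comm]
  have h2 (x : Fin n → ZMod 2) :
      ∑ u, ∑ y, signChar (f x + f y) * signChar (u ⬝ᵥ (x + y)) = 2 ^ n := by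
    rw [Finset.sum_comm]
    simp only [← Finset.mul_sum, sum_signChar_dotProduct, add_eq_zero_iff_eq_of_zmod_two]
    simp [CharTwo.add_self_eq_zero, signChar_zero]
  simp only [h2]
  simp [ZMod.card]

section DimensionFour

variable {f : (Fin 4 → ZMod 2) → ZMod 2}

lemma eight_dvd_sum_signChar_dotProduct (u : Fin 4 → ZMod 2) :
    (8 : ℤ) ∣ ∑ x, signChar (u ⬝ᵥ x) := by
  simp only [dotProduct_comm u, sum_signChar_dotProduct]
  split_ifs <;> norm_num

lemma four_dvd_walsh (hf : ∑ x, signChar (f x) = 0) (u : Fin 4 → ZMod 2) :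
    4 ∣ walsh f u := by
  have h : (4 : ℤ) ∣ ∑ x, (1 - signChar (f x)) * (1 - signChar (u ⬝ᵥ x)) :=
    Finset.dvd_sum fun x _ => four_dvd_one_sub_signChar_mul _ _
  have he : ∑ x, (1 - signChar (f x)) * (1 - signChar (u ⬝ᵥ x)) =
      16 - ∑ x, signChar (f x) - ∑ x, signChar (u ⬝ᵥ x) + walsh f u := by
    have h16 : (16 : ℤ) = ∑ _x : Fin 4 → ZMod 2, 1 := by simp [ZMod.card]
    rw [h16, walsh, ← Finset.sum_sub_distrib, ← Finset.sum_sub_distrib,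
      ← Finset.sum_add_distrib]
    exact Finset.sum_congr rfl fun x _ => by rw [signChar_add]; ring
  have := eight_dvd_sum_signChar_dotProduct u
  omega

lemma eight_dvd_walsh_add (hf : ∑ x, signChar (f x) = 0) (u v : Fin 4 → ZMod 2) :
    8 ∣ walsh f u + walsh f v - walsh f (u + v) := by
  have h : (8 : ℤ) ∣ ∑ x, (1 - signChar (f x)) * (1 - signChar (u ⬝ᵥ x)) *
      (1 - signChar (v ⬝ᵥ x)) :=
    Finset.dvd_sum fun x _ => eight_dvd_one_sub_signChar_mul _ _ _
  have he : ∑ x, (1 - signChar (f x)) * (1 - signChar (u ⬝ᵥ x)) *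
      (1 - signChar (v ⬝ᵥ x)) =
      16 - ∑ x, signChar (f x) - ∑ x, signChar (u ⬝ᵥ x) - ∑ x, signChar (v ⬝ᵥ x)
        + ∑ x, signChar ((u + v) ⬝ᵥ x) + walsh f u + walsh f v - walsh f (u + v) := by
    have h16 : (16 : ℤ) = ∑ _x : Fin 4 → ZMod 2, 1 := by simp [ZMod.card]
    rw [h16, walsh, walsh, walsh]
    simp only [← Finset.sum_sub_distrib, ← Finset.sum_add_distrib]
    exact Finset.sum_congr rfl fun x _ => by simp only [signChar_add, add_dotProduct]; ring
  have := eight_dvd_sum_signChar_dotProduct u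
  have := eight_dvd_sum_signChar_dotProduct v
  have := eight_dvd_sum_signChar_dotProduct (u + v)
  omega

lemma four_mul_sq_sub_le_pow_four (k : ℤ) : 4 * k ^ 2 - 3 * (k % 2) ≤ k ^ 4 := by
  rcases Int.emod_two_eq_zero_or_one k with h | h
  · obtain ⟨m, rfl⟩ := Int.dvd_of_emod_eq_zero h
    have : m ^ 2 ≤ (m ^ 2) ^ 2 := Int.le_self_sq _
    rw [h]; nlinarith
  · obtain ⟨m, rfl⟩ : ∃ m, k = 2 * m + 1 := ⟨k / 2, by omega⟩
    rw [h]
    have h0 : 0 ≤ m * (m + 1) := by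
      rcases le_or_gt 0 m with hm | hm
      · positivity
      · nlinarith
    have h1 : 0 ≤ m * (m + 1) * (m * (m + 1)) := by positivity
    by_cases h2 : m * (m + 1) = 0
    · nlinarith
    · have : 1 ≤ m * (m + 1) := by omega
      nlinarith

/-- A balanced Boolean function of four variables is far from bent. -/
lemma sum_walsh_pow_four_ge (hf : ∑ x, signChar (f x) = 0) :
    10240 ≤ ∑ u, walsh f u ^ 4 := by
  choose w hw using four_dvd_walsh hf
  have hadd (u v) : (w u + w v - w (u + v)) % 2 = 0 := by
    have := eight_dvd_walsh_add hf u v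
    simp only [hw] at this
    omega
  have hsq : ∑ u, w u ^ 2 = 16 := by
    have := sum_walsh_sq f
    simp only [hw, mul_pow, ← Finset.mul_sum] at this
    linarith
  have hodd : ∑ u, w u % 2 ≤ 8 := by
    by_cases h : ∃ v, w v % 2 = 1
    · obtain ⟨v, hv⟩ := h
      have hshift : ∑ u, w (u + v) % 2 = ∑ u, w u % 2 :=
        Equiv.sum_comp (Equiv.addRight v) (fun u => w u % 2)
      have hsum : ∑ u, (w u % 2 + w (u + v) % 2) = ∑ _u : Fin 4 → ZMod 2, 1 :=
        Finset.sum_congr rfl fun u _ => by have := hadd u v; omega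
      rw [Finset.sum_add_distrib, hshift] at hsum
      simp [ZMod.card] at hsum
      omega
    · push Not at h
      have : ∑ u, w u % 2 = 0 := Finset.sum_eq_zero fun u _ => by have := h u; omega
      omega
  have hle := Finset.sum_le_sum fun u (_ : u ∈ Finset.univ) =>
    four_mul_sq_sub_le_pow_four (w u)
  rw [Finset.sum_sub_distrib, ← Finset.mul_sum, ← Finset.mul_sum] at hle
  simp only [hw, mul_pow, ← Finset.mul_sum]
  linarith

lemma sum_walsh_pow_four_le {F : (Fin 4 → ZMod 2) → (Fin 4 → ZMod 2)} (hF : IsAPN F) :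
    ∑ l, ∑ u, walsh (fun x => l ⬝ᵥ F x) u ^ 4 ≤ 256 * 768 := by
  have hexp (l u : Fin 4 → ZMod 2) : walsh (fun x => l ⬝ᵥ F x) u ^ 4 =
      ∑ x, ∑ y, ∑ z, ∑ t, signChar (l ⬝ᵥ (F x + F y + F z + F t)) *
        signChar (u ⬝ᵥ (x + y + z + t)) := by
    have h4 (a : ℤ) : a ^ 4 = a * (a * (a * a)) := by ring
    rw [h4, walsh]
    simp only [Finset.mul_sum, Finset.sum_mul]
    refine Finset.sum_congr rfl fun x _ => Finset.sum_congr rfl fun y _ =>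
      Finset.sum_congr rfl fun z _ => Finset.sum_congr rfl fun t _ => ?_
    simp only [signChar_add, dotProduct_add]
    ring
  have hinner (x y z : Fin 4 → ZMod 2) : ∑ l : Fin 4 → ZMod 2, ∑ u : Fin 4 → ZMod 2, ∑ t,
      signChar (l ⬝ᵥ (F x + F y + F z + F t)) * signChar (u ⬝ᵥ (x + y + z + t)) =
      if F x + F y + F z + F (x + y + z) = 0 then 256 else 0 := by
    have (l : Fin 4 → ZMod 2) : ∑ u : Fin 4 → ZMod 2, ∑ t,
        signChar (l ⬝ᵥ (F x + F y + F z + F t)) * signChar (u ⬝ᵥ (x + y + z + t)) =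
        16 * signChar (l ⬝ᵥ (F x + F y + F z + F (x + y + z))) := by
      rw [Finset.sum_comm]
      simp only [← Finset.mul_sum, sum_signChar_dotProduct, add_eq_zero_iff_eq_of_zmod_two]
      simp [mul_comm]
    simp only [this, ← Finset.mul_sum, sum_signChar_dotProduct]
    split_ifs <;> norm_num
  have hswap : ∑ l, ∑ u, walsh (fun x => l ⬝ᵥ F x) u ^ 4 =
      ∑ x, ∑ y, ∑ z, if F x + F y + F z + F (x + y + z) = 0 then (256 : ℤ) else 0 := by
    simp only [hexp, ← hinner]
    have hpull (g : (Fin 4 → ZMod 2) → (Fin 4 → ZMod 2) → (Fin 4 → ZMod 2) → ℤ) :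
        ∑ l, ∑ u, ∑ x, g l u x = ∑ x, ∑ l, ∑ u, g l u x := by
      rw [Finset.sum_comm]
      conv_lhs => enter [2, u]; rw [Finset.sum_comm]
      rw [Finset.sum_comm]
      exact Finset.sum_congr rfl fun x _ => Finset.sum_comm
    rw [hpull]
    refine Finset.sum_congr rfl fun x _ => ?_
    rw [hpull]
    refine Finset.sum_congr rfl fun y _ => ?_
    rw [hpull]
  have hbound (x y z : Fin 4 → ZMod 2) :
      (if F x + F y + F z + F (x + y + z) = 0 then (256 : ℤ) else 0) ≤
      256 * ((if x = y then 1 else 0) + (if x = z then 1 else 0) +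
        (if y = z then 1 else 0)) := by
    by_cases h : F x + F y + F z + F (x + y + z) = 0
    · rcases hF x y z h with h' | h' | h' <;> rw [if_pos h, if_pos h'] <;>
        split_ifs <;> norm_num
    · rw [if_neg h]
      split_ifs <;> norm_num
  rw [hswap]
  refine (Finset.sum_le_sum fun x _ => Finset.sum_le_sum fun y _ =>
    Finset.sum_le_sum fun z _ => hbound x y z).trans ?_
  simp only [← Finset.mul_sum, Finset.sum_add_distrib]
  simp [ZMod.card]

theorem IsAPN.not_bijective_of_dim_four {F : (Fin 4 → ZMod 2) → (Fin 4 → ZMod 2)}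
    (hF : IsAPN F) : ¬ Function.Bijective F := by
  intro hbij
  have hbal (l : Fin 4 → ZMod 2) (hl : l ≠ 0) : ∑ x, signChar (l ⬝ᵥ F x) = 0 := by
    rw [hbij.sum_comp (fun y => signChar (l ⬝ᵥ y))]
    simp only [dotProduct_comm l, sum_signChar_dotProduct, if_neg hl]
  have hle := sum_walsh_pow_four_le hF
  rw [← Finset.add_sum_erase _ _ (Finset.mem_univ (0 : Fin 4 → ZMod 2))] at hle
  have hzero : (65536 : ℤ) ≤ ∑ u, walsh (fun x => (0 : Fin 4 → ZMod 2) ⬝ᵥ F x) u ^ 4 := by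
    have h0 : walsh (fun x => (0 : Fin 4 → ZMod 2) ⬝ᵥ F x) 0 = 16 := by
      simp [walsh, signChar_zero, ZMod.card]
    have := Finset.single_le_sum
      (f := fun u => walsh (fun x => (0 : Fin 4 → ZMod 2) ⬝ᵥ F x) u ^ 4)
      (fun u _ => by positivity) (Finset.mem_univ 0)
    simp only [h0] at this
    linarith
  have hrest := Finset.card_nsmul_le_sum (Finset.univ.erase (0 : Fin 4 → ZMod 2))
    (fun l => ∑ u, walsh (fun x => l ⬝ᵥ F x) u ^ 4) 10240
    (fun l hl => sum_walsh_pow_four_ge (hbal l (Finset.ne_of_mem_erase hl)))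
  have hcard : (Finset.univ.erase (0 : Fin 4 → ZMod 2)).card = 15 := by
    simp [Finset.card_erase_of_mem, ZMod.card]
  rw [hcard, nsmul_eq_mul, Nat.cast_ofNat] at hrest
  linarith

end DimensionFour

theorem IsAPN.not_bijective_of_dim_two {F : (Fin 2 → ZMod 2) → (Fin 2 → ZMod 2)}
    (hF : IsAPN F) : ¬ Function.Bijective F := by
  intro hbij
  have huniv : (Finset.univ : Finset (Fin 2 → ZMod 2)) =
      {0, ![1, 0], ![0, 1], 0 + ![1, 0] + ![0, 1]} := by decide
  have hsum : ∑ x, F x = 0 := by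
    rw [hbij.sum_comp (fun y => y)]
    decide
  rw [huniv, Finset.sum_insert (by decide), Finset.sum_insert (by decide),
    Finset.sum_insert (by decide), Finset.sum_singleton, ← add_assoc, ← add_assoc] at hsum
  have := hF _ _ _ hsum
  revert this
  decide

/-- Nonexistence of APN permutations of `F₂ᵐ` carries over to spaces of dimension `m`. -/
lemma IsAPN.false_of_bijective {V W : Type*} [AddCommGroup V] [Module (ZMod 2) V]
    [Module.Finite (ZMod 2) V] [AddCommGroup W] [Module (ZMod 2) W] [Module.Finite (ZMod 2) W]
    {G : V → W} (hG : IsAPN G) (hbij : Function.Bijective G) {m : ℕ}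
    (hm : ∀ {F : (Fin m → ZMod 2) → (Fin m → ZMod 2)}, IsAPN F → ¬ Function.Bijective F)
    (hV : Module.finrank (ZMod 2) V = m) (hW : Module.finrank (ZMod 2) W = m) : False := by
  let e₁ := LinearEquiv.ofFinrankEq (R := ZMod 2) V (Fin m → ZMod 2) (by simp [hV])
  let e₂ := LinearEquiv.ofFinrankEq (R := ZMod 2) W (Fin m → ZMod 2) (by simp [hW])
  refine hm (F := e₂ ∘ G ∘ e₁.symm) ?_ (e₂.bijective.comp (hbij.comp e₁.symm.bijective))
  intro x y z h
  simpa using hG (e₁.symm x) (e₁.symm y) (e₁.symm z)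
    (e₂.map_eq_zero_iff.mp (by simpa only [Function.comp_apply, map_add] using h))

lemma isAPN_of_ncard_le_two {V W : Type*} [AddCommGroup V] [Module (ZMod 2) V] [Finite V]
    [AddCommGroup W] [Module (ZMod 2) W] {F : V → W}
    (hF : ∀ a : V, a ≠ 0 → ∀ b : W, Set.ncard {x : V | F x + F (x + a) = b} ≤ 2) :
    IsAPN F := by
  intro x y z h
  by_contra! hne
  obtain ⟨hxy, hxz, hyz⟩ := hne
  have hsub : ({x, y, z} : Set V) ⊆ {t | F t + F (t + (x + y)) = F x + F y} := by
    rintro t (rfl | rfl | rfl)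
    · rw [Set.mem_ofPred_eq, ← add_assoc, ZModModule.add_self, zero_add]
    · rw [Set.mem_ofPred_eq, add_left_comm, ZModModule.add_self, add_zero, add_comm]
    · rw [Set.mem_ofPred_eq, ← add_eq_zero_iff_eq_of_zmod_two, ← h, add_comm t]
      abel
  have h3 : ({x, y, z} : Set V).ncard = 3 := Set.ncard_eq_three.mpr ⟨x, y, z, hxy, hxz, hyz, rfl⟩
  have hle := Set.ncard_le_ncard hsub (Set.toFinite _)
  have := hF (x + y) (by rwa [Ne, add_eq_zero_iff_eq_of_zmod_two]) (F x + F y)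
  omega

/-- An APN permutation cannot map a subspace of codimension one, up to translation, onto
another one. -/
lemma false_of_mem_iff_of_index_eq_two {V : Type*} [AddCommGroup V] [Module (ZMod 2) V]
    [Finite V] {F : V → V} (hinj : Function.Injective F)
    (hF : ∀ a : V, a ≠ 0 → ∀ b : V, Set.ncard {x : V | F x + F (x + a) = b} ≤ 2)
    (H K : AddSubgroup V) (hK : K.index = 2) (p q : V)
    (hHK : ∀ x, x + p ∈ H ↔ F x + q ∈ K) {a : V} (haH : a ∈ H) (ha : a ≠ 0) : False := by
  classical
  have := Fintype.ofFinite V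
  have hself (x : V) : x + x = 0 := ZModModule.add_self x
  have hmem (x : V) : F x + F (x + a) ∈ K := by
    have h : F x + F (x + a) = (F x + q) + (F (x + a) + q) := by
      rw [add_add_add_comm, hself, add_zero]
    rw [h, AddSubgroup.add_mem_iff_of_index_two hK, ← hHK, ← hHK, add_right_comm,
      AddSubgroup.add_mem_cancel_right H haH]
  have hne (x : V) : F x + F (x + a) ≠ 0 := by
    rw [Ne, add_eq_zero_iff_eq_of_zmod_two]
    intro h
    exact ha (by simpa using hinj h)
  have hcard : (Finset.univ : Finset V).card ≤
      2 * ((Finset.univ.filter (· ∈ K)).erase (0 : V)).card := by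
    refine Finset.card_le_mul_card_image_of_maps_to (f := fun x => F x + F (x + a))
      (fun x _ => by simp [hmem x, hne x]) 2 fun b _ => ?_
    have := hF a ha b
    rwa [Set.ncard_eq_toFinset_card', Set.toFinset_ofPred] at this
  rw [Finset.card_erase_of_mem (by simp), Finset.card_univ, ← Fintype.card_subtype,
    ← Nat.card_eq_fintype_card, ← Nat.card_eq_fintype_card] at hcard
  have hmul := K.card_mul_index
  rw [hK] at hmul
  have hpos : 0 < Nat.card K := Nat.card_pos
  omega

/-- An APN permutation of `F₂ⁿ` (`n ≥ 2`) cannot map an affine subspace of dimension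
`2`, `4`, or `n-1` onto an affine subspace. -/
theorem stmt_14 (n : ℕ) (hn : 2 ≤ n) (F : (Fin n → ZMod 2) → (Fin n → ZMod 2))
    (hbij : Function.Bijective F)
    (hAPN : ∀ a : Fin n → ZMod 2, a ≠ 0 → ∀ b : Fin n → ZMod 2,
      Set.ncard {x : Fin n → ZMod 2 | F x + F (x + a) = b} ≤ 2)
    (A₁ A₂ : AffineSubspace (ZMod 2) (Fin n → ZMod 2))
    (h1 : (A₁ : Set (Fin n → ZMod 2)).Nonempty)
    (him : F '' (A₁ : Set (Fin n → ZMod 2)) = (A₂ : Set (Fin n → ZMod 2))) :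
    Module.finrank (ZMod 2) A₁.direction ∉ ({2, 4, n - 1} : Set ℕ) := by
  obtain ⟨p, hp⟩ := h1
  have hFmem (x) : F x ∈ A₂ ↔ x ∈ A₁ := by
    rw [← SetLike.mem_coe, ← him, hbij.injective.mem_set_image, SetLike.mem_coe]
  have hq : F p ∈ A₂ := (hFmem p).mpr hp
  have hdir (x) : x + p ∈ A₁.direction ↔ F x + F p ∈ A₂.direction := by
    rw [← ZModModule.sub_eq_add, ← ZModModule.sub_eq_add, ← vsub_eq_sub, ← vsub_eq_sub,
      AffineSubspace.vsub_right_mem_direction_iff_mem hp,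
      AffineSubspace.vsub_right_mem_direction_iff_mem hq, hFmem]
  have hself (x : Fin n → ZMod 2) : x + x = 0 := ZModModule.add_self x
  let G : A₁.direction → A₂.direction := fun d =>
    ⟨F (d + p) + F p, (hdir _).mp (by rw [add_assoc, hself, add_zero]; exact d.2)⟩
  have hG : Function.Bijective G := by
    constructor
    · intro d e h
      have h' : F (d + p) + F p = F (e + p) + F p := congrArg Subtype.val h
      exact Subtype.ext (add_right_cancel (hbij.injective (add_right_cancel h')))
    · intro e
      obtain ⟨x, hx⟩ := hbij.surjective (e + F p)
      refine ⟨⟨x + p, (hdir x).mpr (by rw [hx, add_assoc, hself, add_zero]; exact e.2)⟩, ?_⟩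
      apply Subtype.ext
      change F (x + p + p) + F p = e
      rw [add_assoc, hself, add_zero, hx, add_assoc, hself, add_zero]
  have hF' : IsAPN F := isAPN_of_ncard_le_two hAPN
  have hGAPN : IsAPN G := by
    intro x y z h
    have h' : F (x + p) + F p + (F (y + p) + F p) + (F (z + p) + F p) +
      (F (x + y + z + p) + F p) = 0 := congrArg Subtype.val h
    have hsum : (x : Fin n → ZMod 2) + p + (y + p) + (z + p) = x + y + z + p := by
      rw [add_add_add_comm (x : Fin n → ZMod 2), hself, add_zero, add_assoc]
      abel
    have hzero : F (x + p) + F (y + p) + F (z + p) + F (x + p + (y + p) + (z + p)) = 0 := by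
      calc _ = F (x + p) + F p + (F (y + p) + F p) + (F (z + p) + F p) +
            (F (x + y + z + p) + F p) - (F p + F p) - (F p + F p) := by rw [hsum]; abel
        _ = 0 := by rw [h', hself, sub_zero, sub_zero]
    exact (hF' _ _ _ hzero).imp (fun h => Subtype.ext (add_right_cancel h))
      (Or.imp (fun h => Subtype.ext (add_right_cancel h))
        (fun h => Subtype.ext (add_right_cancel h)))
  have hcard : Nat.card A₁.direction = Nat.card A₂.direction := Nat.card_eq_of_bijective G hG
  have hfin : Module.finrank (ZMod 2) A₁.direction = Module.finrank (ZMod 2) A₂.direction := by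
    rw [Module.natCard_eq_pow_finrank (K := ZMod 2),
      Module.natCard_eq_pow_finrank (K := ZMod 2) (V := A₂.direction), Nat.card_zmod] at hcard
    exact Nat.pow_right_injective le_rfl hcard
  rintro (h | h | h)
  · exact hGAPN.false_of_bijective hG IsAPN.not_bijective_of_dim_two h (hfin ▸ h)
  · exact hGAPN.false_of_bijective hG IsAPN.not_bijective_of_dim_four h (hfin ▸ h)
  · have hidx : A₂.direction.toAddSubgroup.index = 2 := by
      have hmul := A₂.direction.toAddSubgroup.card_mul_index
      have hD : Nat.card A₂.direction.toAddSubgroup = 2 ^ (n - 1) := by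
        have := Module.natCard_eq_pow_finrank (K := ZMod 2) (V := A₂.direction)
        rwa [Nat.card_zmod, ← hfin, h] at this
      have hV : Nat.card (Fin n → ZMod 2) = 2 ^ (n - 1) * 2 := by
        rw [← pow_succ, Nat.sub_add_cancel (by omega)]
        simp
      rw [hD, hV] at hmul
      exact Nat.eq_of_mul_eq_mul_left (by positivity) hmul
    have : Nontrivial A₁.direction := Module.nontrivial_of_finrank_pos (R := ZMod 2) (by
      rw [h]; omega)
    obtain ⟨a, ha⟩ := exists_ne (0 : A₁.direction)
    exact false_of_mem_iff_of_index_eq_two hbij.injective hAPN A₁.direction.toAddSubgroup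
      A₂.direction.toAddSubgroup hidx p (F p) hdir a.2 (by simpa using ha)
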